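/- Let X and Y be random vectors in {0,1}^N whose laws have full support (which in particular makes the Glauber dynamics for the law of X irreducible). Define the influence matrix R̂ of X by R̂_{rs} := max_{x∈{0,1}^N} | q_X((x^{(s,1)})^{(r,1)} | x^{(s,1)}) − q_X((x^{(s,0)})^{(r,1)} | x^{(s,0)}) |. Fix 1 ≤ p ≤ ∞ and ε > 0, and suppose there exists an N×N real matrix R with R̂_{rs} ≤ R_{rs} for all r,s ∈ [N] and with matrix operator norm ‖R‖_p := sup_{v ≠ 0} ‖Rv‖_p/‖v‖_p ≤ 1 − ε. Let h : {0,1}^N → ℝ, set c_s := max_{x∈{0,1}^N} |Δ_s h(x)| and c := (c_1,…,c_N), and for y ∈ {0,1}^N set v_s(y) := | q_X(y^{(s,1)}|y) − q_Y(y^{(s,1)}|y) | and v(y) := (v_1(y),…,v_N(y)). Then, with q := p/(p−1) the conjugate exponent, |E h(X) − E h(Y)| ≤ ε^{−1} ‖c‖_q · E‖v(Y)‖_p. -/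

import Mathlib

open scoped ENNReal

/-! Statement 6: stability theorem (Theorem 2.1 of Reinert–Ross) for laws on `{0,1}^N` with
full support, under a contraction condition on a dominating influence matrix in matrix
operator `p`-norm. Laws are represented by their probability mass functions `qX, qY`. -/

/-- `x` with coordinate `s` set to `1` (true). -/
def up1 {N : ℕ} (x : Fin N → Bool) (s : Fin N) : Fin N → Bool := Function.update x s true

/-- `x` with coordinate `s` set to `0` (false). -/
def up0 {N : ℕ} (x : Fin N → Bool) (s : Fin N) : Fin N → Bool := Function.update x s false

/-- The conditional probability `q_W(y^{(s,1)} | y)` of an edge at `s` (given the rest of `y`). -/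
noncomputable def condProb1 {N : ℕ} (q : (Fin N → Bool) → ℝ) (s : Fin N)
    (x : Fin N → Bool) : ℝ :=
  q (up1 x s) / (q (up1 x s) + q (up0 x s))

/-- The `ℓ^p` norm on `ℝ^N`, for `p ∈ [1,∞]` (with `‖v‖_∞ = max_s |v_s|`). -/
noncomputable def pNorm {N : ℕ} (p : ℝ≥0∞) (v : Fin N → ℝ) : ℝ :=
  if p = ∞ then ⨆ s, |v s| else (∑ s : Fin N, |v s| ^ p.toReal) ^ (1 / p.toReal)

/-- The influence matrix entry
`R̂_{rs} = max_x | q_X((x^{(s,1)})^{(r,1)} | x^{(s,1)}) − q_X((x^{(s,0)})^{(r,1)} | x^{(s,0)}) |`. -/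
noncomputable def influence {N : ℕ} (qX : (Fin N → Bool) → ℝ) (r s : Fin N) : ℝ :=
  ⨆ x : Fin N → Bool, |condProb1 qX r (up1 x s) - condProb1 qX r (up0 x s)|

/-- Resampling the coordinate `s` from its conditional law under `q`. -/
noncomputable def resample {N : ℕ} (q : (Fin N → Bool) → ℝ) (s : Fin N)
    (f : (Fin N → Bool) → ℝ) (x : Fin N → Bool) : ℝ :=
  condProb1 q s x * f (up1 x s) + (1 - condProb1 q s x) * f (up0 x s)

/-- The maximal discrete derivative of `f` in direction `s`. -/
noncomputable def maxDelta {N : ℕ} (f : (Fin N → Bool) → ℝ) (s : Fin N) : ℝ :=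
  ⨆ x : Fin N → Bool, |f (up1 x s) - f (up0 x s)|

section Cube

variable {N : ℕ}

lemma up1_up1 (x : Fin N → Bool) (s : Fin N) : up1 (up1 x s) s = up1 x s := by
  simp [up1]

lemma up1_up0 (x : Fin N → Bool) (s : Fin N) : up1 (up0 x s) s = up1 x s := by
  simp [up1, up0]

lemma up0_up1 (x : Fin N → Bool) (s : Fin N) : up0 (up1 x s) s = up0 x s := by
  simp [up1, up0]

lemma up0_up0 (x : Fin N → Bool) (s : Fin N) : up0 (up0 x s) s = up0 x s := by
  simp [up0]

lemma up1_eq_self {x : Fin N → Bool} {s : Fin N} (hx : x s = true) : up1 x s = x := by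
  rw [up1, ← hx, Function.update_eq_self]

lemma up0_eq_self {x : Fin N → Bool} {s : Fin N} (hx : x s = false) : up0 x s = x := by
  rw [up0, ← hx, Function.update_eq_self]

lemma abs_sub_le_maxDelta (f : (Fin N → Bool) → ℝ) (s : Fin N) (x : Fin N → Bool) :
    |f (up1 x s) - f (up0 x s)| ≤ maxDelta f s :=
  le_ciSup (f := fun x => |f (up1 x s) - f (up0 x s)|) (Set.finite_range _).bddAbove x

lemma maxDelta_nonneg (f : (Fin N → Bool) → ℝ) (s : Fin N) : 0 ≤ maxDelta f s :=
  Real.iSup_nonneg fun _ => abs_nonneg _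

lemma influence_nonneg (q : (Fin N → Bool) → ℝ) (r s : Fin N) : 0 ≤ influence q r s :=
  maxDelta_nonneg _ _

lemma condProb1_nonneg {q : (Fin N → Bool) → ℝ} (hq : ∀ x, 0 < q x) (s : Fin N)
    (x : Fin N → Bool) : 0 ≤ condProb1 q s x :=
  div_nonneg (hq _).le (add_pos (hq _) (hq _)).le

lemma condProb1_le_one {q : (Fin N → Bool) → ℝ} (hq : ∀ x, 0 < q x) (s : Fin N)
    (x : Fin N → Bool) : condProb1 q s x ≤ 1 :=
  (div_le_one (add_pos (hq _) (hq _))).2 (le_add_of_nonneg_right (hq _).le)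

lemma condProb1_up1 (q : (Fin N → Bool) → ℝ) (s : Fin N) (x : Fin N → Bool) :
    condProb1 q s (up1 x s) = condProb1 q s x := by
  simp only [condProb1, up1_up1, up0_up1]

lemma condProb1_up0 (q : (Fin N → Bool) → ℝ) (s : Fin N) (x : Fin N → Bool) :
    condProb1 q s (up0 x s) = condProb1 q s x := by
  simp only [condProb1, up1_up0, up0_up0]

lemma resample_up1 (q f : (Fin N → Bool) → ℝ) (s : Fin N) (x : Fin N → Bool) :
    resample q s f (up1 x s) = resample q s f x := by
  simp only [resample, condProb1_up1, up1_up1, up0_up1]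

lemma resample_up0 (q f : (Fin N → Bool) → ℝ) (s : Fin N) (x : Fin N → Bool) :
    resample q s f (up0 x s) = resample q s f x := by
  simp only [resample, condProb1_up0, up1_up0, up0_up0]

lemma sum_eq_zero_of_up1_add_up0 (F : (Fin N → Bool) → ℝ) (s : Fin N)
    (hF : ∀ x, F (up1 x s) + F (up0 x s) = 0) : ∑ x, F x = 0 := by
  refine Finset.sum_involution (fun x _ => Function.update x s (!x s)) ?_ ?_ ?_ ?_
  · intro x _
    cases hx : x s
    · have := hF x
      rw [up0_eq_self hx] at this
      simpa [up1, add_comm] using this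
    · have := hF x
      rw [up1_eq_self hx] at this
      simpa [up0] using this
  · intro x _ _ hx
    have := congrFun hx s
    simp at this
  · intro x _
    exact Finset.mem_univ _
  · intro x _
    simp

/-- The law `q` is invariant under resampling from its own conditional laws. -/
lemma sum_mul_resample {q : (Fin N → Bool) → ℝ} (hq : ∀ x, 0 < q x) (s : Fin N)
    (f : (Fin N → Bool) → ℝ) : ∑ x, q x * resample q s f x = ∑ x, q x * f x := by
  rw [← sub_eq_zero, ← Finset.sum_sub_distrib]
  refine sum_eq_zero_of_up1_add_up0 _ s fun x => ?_
  rw [resample_up1, resample_up0, resample, condProb1]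
  have := (add_pos (hq (up1 x s)) (hq (up0 x s))).ne'
  field_simp
  ring

lemma abs_resample_sub_resample_le (q q' f : (Fin N → Bool) → ℝ) (s : Fin N)
    (x : Fin N → Bool) :
    |resample q s f x - resample q' s f x| ≤
      |condProb1 q s x - condProb1 q' s x| * maxDelta f s := by
  have h : resample q s f x - resample q' s f x =
      (condProb1 q s x - condProb1 q' s x) * (f (up1 x s) - f (up0 x s)) := by
    simp only [resample]; ring
  rw [h, abs_mul]
  gcongr
  exact abs_sub_le_maxDelta f s x

lemma maxDelta_resample_self (q f : (Fin N → Bool) → ℝ) (s : Fin N) :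
    maxDelta (resample q s f) s = 0 := by
  simp [maxDelta, resample_up1, resample_up0]

lemma maxDelta_resample_le {q : (Fin N → Bool) → ℝ} (hq : ∀ x, 0 < q x)
    (f : (Fin N → Bool) → ℝ) {r s : Fin N} (hrs : r ≠ s) :
    maxDelta (resample q r f) s ≤ maxDelta f s + influence q r s * maxDelta f r := by
  refine ciSup_le fun x => ?_
  have c1 : ∀ a b, Function.update (Function.update x s a) r b =
      Function.update (Function.update x r b) s a := fun a b =>
    Function.update_comm hrs.symm a b x
  set a := condProb1 q r (up1 x s)
  set b := condProb1 q r (up0 x s)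
  have key : resample q r f (up1 x s) - resample q r f (up0 x s) =
      a * (f (up1 (up1 x r) s) - f (up0 (up1 x r) s)) +
      (1 - a) * (f (up1 (up0 x r) s) - f (up0 (up0 x r) s)) +
      (a - b) * (f (up1 (up0 x s) r) - f (up0 (up0 x s) r)) := by
    simp only [resample, a, b]
    simp only [up1, up0, c1]
    ring
  have ha0 : 0 ≤ a := condProb1_nonneg hq _ _
  have ha1 : 0 ≤ 1 - a := sub_nonneg.2 (condProb1_le_one hq _ _)
  have hab : |a - b| ≤ influence q r s := abs_sub_le_maxDelta (condProb1 q r) s x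
  rw [key]
  calc _ ≤ _ := abs_add_three _ _ _
    _ = a * |f (up1 (up1 x r) s) - f (up0 (up1 x r) s)| +
        (1 - a) * |f (up1 (up0 x r) s) - f (up0 (up0 x r) s)| +
        |a - b| * |f (up1 (up0 x s) r) - f (up0 (up0 x s) r)| := by
      rw [abs_mul, abs_mul, abs_mul, abs_of_nonneg ha0, abs_of_nonneg ha1]
    _ ≤ a * maxDelta f s + (1 - a) * maxDelta f s + influence q r s * maxDelta f r := by
      gcongr
      · exact abs_sub_le_maxDelta f s _
      · exact abs_sub_le_maxDelta f s _
      · exact influence_nonneg q r s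
      · exact abs_sub_le_maxDelta f r _
    _ = _ := by ring

lemma abs_update_sub_le (f : (Fin N → Bool) → ℝ) (s : Fin N) (x : Fin N → Bool) (b : Bool) :
    |f (Function.update x s b) - f x| ≤ maxDelta f s := by
  have h := abs_sub_le_maxDelta f s x
  cases b <;> cases hx : x s
  · rw [show Function.update x s false = x from up0_eq_self hx]
    simpa using maxDelta_nonneg f s
  · rw [up1_eq_self hx, abs_sub_comm] at h
    exact h
  · rw [up0_eq_self hx] at h
    exact h
  · rw [show Function.update x s true = x from up1_eq_self hx]
    simpa using maxDelta_nonneg f s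

lemma abs_sub_le_sum_maxDelta (f : (Fin N → Bool) → ℝ) (x y : Fin N → Bool) :
    |f x - f y| ≤ ∑ s, maxDelta f s := by
  have key : ∀ S : Finset (Fin N), |f (S.piecewise x y) - f y| ≤ ∑ s ∈ S, maxDelta f s := by
    intro S
    induction S using Finset.induction_on with
    | empty => simp
    | insert s S hs ih =>
      rw [Finset.sum_insert hs, Finset.piecewise_insert]
      exact (abs_sub_le _ _ _).trans (add_le_add (abs_update_sub_le f s _ _) ih)
  simpa using key Finset.univ

lemma abs_sum_sub_sum_le_sum_maxDelta {q q' : (Fin N → Bool) → ℝ} (hq : ∀ x, 0 < q x)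
    (hqsum : ∑ x, q x = 1) (hq' : ∀ x, 0 < q' x) (hqsum' : ∑ x, q' x = 1)
    (f : (Fin N → Bool) → ℝ) :
    |∑ x, q x * f x - ∑ y, q' y * f y| ≤ ∑ s, maxDelta f s := by
  have h : ∑ x, q x * f x - ∑ y, q' y * f y = ∑ x, ∑ y, q x * q' y * (f x - f y) := by
    simp only [mul_sub, Finset.sum_sub_distrib]
    congr 1
    · refine Finset.sum_congr rfl fun x _ => ?_
      rw [← Finset.sum_mul, ← Finset.mul_sum, hqsum', mul_one]
    · rw [Finset.sum_comm]
      refine Finset.sum_congr rfl fun y _ => ?_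
      rw [← Finset.sum_mul, ← Finset.sum_mul, hqsum, one_mul]
  rw [h]
  calc _ ≤ ∑ x, ∑ y, q x * q' y * ∑ s, maxDelta f s := by
        refine (Finset.abs_sum_le_sum_abs _ _).trans (Finset.sum_le_sum fun x _ => ?_)
        refine (Finset.abs_sum_le_sum_abs _ _).trans (Finset.sum_le_sum fun y _ => ?_)
        have h0 := (mul_pos (hq x) (hq' y)).le
        rw [abs_mul, abs_of_nonneg h0]
        exact mul_le_mul_of_nonneg_left (abs_sub_le_sum_maxDelta f x y) h0
    _ = _ := by
        simp only [← Finset.sum_mul, ← Finset.mul_sum, hqsum, hqsum', one_mul]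

/-- A bound on the difference of expectations that is linear in the maximal discrete derivatives,
with weights `w`, is improved by averaging over one step of the Glauber dynamics. -/
lemma abs_sum_sub_sum_le_of_resample {qX qY : (Fin N → Bool) → ℝ} (hqX : ∀ x, 0 < qX x)
    (hqY : ∀ x, 0 < qY x) {R : Matrix (Fin N) (Fin N) ℝ}
    (hR : ∀ r s, influence qX r s ≤ R r s) {w : Fin N → ℝ} (hw : ∀ s, 0 ≤ w s)
    (hbound : ∀ f : (Fin N → Bool) → ℝ,
      |∑ x, qX x * f x - ∑ y, qY y * f y| ≤ ∑ s, maxDelta f s * w s)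
    (f : (Fin N → Bool) → ℝ) :
    N * |∑ x, qX x * f x - ∑ y, qY y * f y| ≤
      ∑ s, maxDelta f s * ((N - 1) * w s + R.mulVec w s +
        ∑ y, qY y * |condProb1 qX s y - condProb1 qY s y|) := by
  have step : ∀ r : Fin N, |∑ x, qX x * f x - ∑ y, qY y * f y| ≤
      (∑ s, maxDelta f s * w s - maxDelta f r * w r) + maxDelta f r * R.mulVec w r +
        maxDelta f r * ∑ y, qY y * |condProb1 qX r y - condProb1 qY r y| := by
    intro r
    have h1 : ∑ x, qX x * f x - ∑ y, qY y * f y =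
        (∑ x, qX x * resample qX r f x - ∑ y, qY y * resample qX r f y) +
        ∑ y, qY y * (resample qX r f y - resample qY r f y) := by
      simp only [mul_sub, Finset.sum_sub_distrib, sum_mul_resample hqX, sum_mul_resample hqY]
      ring
    rw [h1]
    refine (abs_add_le _ _).trans (add_le_add ((hbound _).trans ?_) ?_)
    · rw [Matrix.mulVec, dotProduct, Finset.mul_sum,
        ← Finset.sum_erase_eq_sub (Finset.mem_univ r),
        ← Finset.sum_erase (a := r) Finset.univ
          (by rw [maxDelta_resample_self, zero_mul])]
      have hnn : ∀ s, 0 ≤ maxDelta f r * (R r s * w s) := fun s =>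
        mul_nonneg (maxDelta_nonneg f r)
          (mul_nonneg ((influence_nonneg qX r s).trans (hR r s)) (hw s))
      refine le_trans ?_ (add_le_add_right (Finset.sum_le_sum_of_subset_of_nonneg
        (Finset.erase_subset r Finset.univ) fun s _ _ => hnn s) _)
      rw [← Finset.sum_add_distrib]
      refine Finset.sum_le_sum fun s hs => ?_
      have hrs : r ≠ s := (Finset.ne_of_mem_erase hs).symm
      calc _ ≤ (maxDelta f s + R r s * maxDelta f r) * w s := by
            refine mul_le_mul_of_nonneg_right ((maxDelta_resample_le hqX f hrs).trans ?_) (hw s)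
            gcongr
            · exact maxDelta_nonneg f r
            · exact hR r s
        _ = _ := by ring
    · rw [Finset.mul_sum]
      refine (Finset.abs_sum_le_sum_abs _ _).trans (Finset.sum_le_sum fun y _ => ?_)
      rw [abs_mul, abs_of_pos (hqY y)]
      calc _ ≤ qY y * (|condProb1 qX r y - condProb1 qY r y| * maxDelta f r) :=
            mul_le_mul_of_nonneg_left (abs_resample_sub_resample_le _ _ _ _ _) (hqY y).le
        _ = _ := by ring
  have hsum := Finset.sum_le_sum fun r (_ : r ∈ Finset.univ) => step r
  simp only [Finset.sum_const, Finset.card_univ, Fintype.card_fin, nsmul_eq_mul,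
    Finset.sum_add_distrib, Finset.sum_sub_distrib] at hsum
  refine hsum.trans_eq ?_
  simp only [mul_add, Finset.sum_add_distrib, mul_left_comm _ ((N : ℝ) - 1), ← Finset.mul_sum]
  ring

end Cube

section Norm

variable {N : ℕ}

lemma pNorm_eq_norm (p : ℝ≥0∞) [Fact (1 ≤ p)] (v : Fin N → ℝ) :
    pNorm p v = ‖WithLp.toLp p v‖ := by
  have hp : 1 ≤ p := Fact.out
  unfold pNorm
  split_ifs with h
  · subst h
    simp [PiLp.norm_eq_ciSup]
  · rw [PiLp.norm_eq_sum (ENNReal.toReal_pos (zero_lt_one.trans_le hp).ne' h)]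
    simp

lemma pNorm_nonneg {p : ℝ≥0∞} (hp : 1 ≤ p) (v : Fin N → ℝ) : 0 ≤ pNorm p v := by
  have : Fact (1 ≤ p) := ⟨hp⟩
  rw [pNorm_eq_norm]
  exact norm_nonneg _

lemma pNorm_add_le {p : ℝ≥0∞} (hp : 1 ≤ p) (v w : Fin N → ℝ) :
    pNorm p (v + w) ≤ pNorm p v + pNorm p w := by
  have : Fact (1 ≤ p) := ⟨hp⟩
  simp only [pNorm_eq_norm, WithLp.toLp_add]
  exact norm_add_le _ _

lemma pNorm_smul {p : ℝ≥0∞} (hp : 1 ≤ p) {a : ℝ} (ha : 0 ≤ a) (v : Fin N → ℝ) :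
    pNorm p (a • v) = a * pNorm p v := by
  have : Fact (1 ≤ p) := ⟨hp⟩
  rw [pNorm_eq_norm, pNorm_eq_norm, WithLp.toLp_smul, norm_smul, Real.norm_of_nonneg ha]

lemma pNorm_zero {p : ℝ≥0∞} (hp : 1 ≤ p) : pNorm p (0 : Fin N → ℝ) = 0 := by
  have : Fact (1 ≤ p) := ⟨hp⟩
  rw [pNorm_eq_norm, WithLp.toLp_zero, norm_zero]

lemma pNorm_sum_le {ι : Type*} {p : ℝ≥0∞} (hp : 1 ≤ p) (t : Finset ι)
    (v : ι → Fin N → ℝ) : pNorm p (∑ i ∈ t, v i) ≤ ∑ i ∈ t, pNorm p (v i) :=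
  Finset.le_sum_of_subadditive (pNorm p) (pNorm_zero hp).le (pNorm_add_le hp) t v

lemma pNorm_pos {p : ℝ≥0∞} (hp : 1 ≤ p) {v : Fin N → ℝ} (hv : v ≠ 0) : 0 < pNorm p v := by
  have : Fact (1 ≤ p) := ⟨hp⟩
  rw [pNorm_eq_norm, norm_pos_iff]
  exact fun h => hv ((WithLp.toLp_eq_zero p).1 h)

lemma pNorm_one (v : Fin N → ℝ) : pNorm 1 v = ∑ s, |v s| := by
  simp [pNorm]

lemma abs_le_pNorm_top (v : Fin N → ℝ) (s : Fin N) : |v s| ≤ pNorm ∞ v := by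
  simp only [pNorm, if_true]
  exact le_ciSup (f := fun s => |v s|) (Set.finite_range _).bddAbove s

lemma sum_mul_le_pNorm_top_mul_pNorm_one (v w : Fin N → ℝ) :
    ∑ s, v s * w s ≤ pNorm ∞ v * pNorm 1 w := by
  rw [pNorm_one, Finset.mul_sum]
  refine Finset.sum_le_sum fun s _ => (le_abs_self _).trans ?_
  rw [abs_mul]
  exact mul_le_mul_of_nonneg_right (abs_le_pNorm_top v s) (abs_nonneg _)

/-- Hölder's inequality for `pNorm`. -/
lemma sum_mul_le_pNorm_mul_pNorm {p q : ℝ≥0∞} (hpq : 1 / p + 1 / q = 1) (v w : Fin N → ℝ) :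
    ∑ s, v s * w s ≤ pNorm q v * pNorm p w := by
  by_cases hp : p = ∞
  · obtain rfl : q = 1 := by simpa [hp] using hpq
    rw [hp, mul_comm]
    simpa only [mul_comm] using sum_mul_le_pNorm_top_mul_pNorm_one w v
  by_cases hq : q = ∞
  · obtain rfl : p = 1 := by simpa [hq] using hpq
    rw [hq]
    exact sum_mul_le_pNorm_top_mul_pNorm_one v w
  have : ENNReal.HolderConjugate q p := ⟨by simpa [add_comm] using hpq⟩
  simpa [pNorm, hp, hq] using Real.inner_le_Lp_mul_Lq Finset.univ v w
    (ENNReal.HolderConjugate.toReal_of_ne_top hq hp)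

end Norm

theorem stability_of_glauber (n N : ℕ) (hn : 2 ≤ n) (hN : N = n * (n - 1) / 2)
    (qX qY : (Fin N → Bool) → ℝ)
    (hqX : ∀ x, 0 < qX x) (hqXsum : ∑ x : Fin N → Bool, qX x = 1)
    (hqY : ∀ x, 0 < qY x) (hqYsum : ∑ x : Fin N → Bool, qY x = 1)
    (p q : ℝ≥0∞) (hp : 1 ≤ p) (hq : 1 / p + 1 / q = 1)
    (ε : ℝ) (hε : 0 < ε)
    (R : Matrix (Fin N) (Fin N) ℝ)
    (hR : ∀ r s : Fin N, influence qX r s ≤ R r s)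
    (hRnorm : ∀ v : Fin N → ℝ, pNorm p (R.mulVec v) ≤ (1 - ε) * pNorm p v)
    (h : (Fin N → Bool) → ℝ) :
    |(∑ x : Fin N → Bool, qX x * h x) - ∑ y : Fin N → Bool, qY y * h y| ≤
      ε⁻¹ * pNorm q (fun s => ⨆ x : Fin N → Bool, |h (up1 x s) - h (up0 x s)|) *
        ∑ y : Fin N → Bool, qY y *
          pNorm p (fun s => |condProb1 qX s y - condProb1 qY s y|) := by
  have hNpos : 0 < N := by
    have : 2 * 1 ≤ n * (n - 1) := Nat.mul_le_mul hn (by omega)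
    omega
  have hN1 : (1 : ℝ) ≤ N := by exact_mod_cast hNpos
  have hN0 : (0 : ℝ) < N := by linarith
  have hq1 : 1 ≤ q := by
    have hle : 1 / q ≤ 1 / p + 1 / q := le_add_self
    rwa [hq, one_div, ENNReal.inv_le_one] at hle
  have hε1 : ε ≤ 1 := by
    have hne : (fun _ => 1 : Fin N → ℝ) ≠ 0 := fun h0 => one_ne_zero (congrFun h0 ⟨0, hNpos⟩)
    have h1 := (pNorm_nonneg hp _).trans (hRnorm fun _ => 1)
    have h2 := nonneg_of_mul_nonneg_left h1 (pNorm_pos hp hne)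
    linarith
  set V : ℝ := ∑ y, qY y * pNorm p (fun s => |condProb1 qX s y - condProb1 qY s y|) with hV
  set v : Fin N → ℝ := fun s => ∑ y, qY y * |condProb1 qX s y - condProb1 qY s y| with hv
  have hv0 : ∀ s, 0 ≤ v s := fun s =>
    Finset.sum_nonneg fun y _ => mul_nonneg (hqY y).le (abs_nonneg _)
  have hvV : pNorm p v ≤ V := by
    have hveq : v = ∑ y, qY y • fun s => |condProb1 qX s y - condProb1 qY s y| := by
      ext s
      simp [hv, Finset.sum_apply]
    rw [hveq]
    refine (pNorm_sum_le hp _ _).trans_eq (Finset.sum_congr rfl fun y _ => ?_)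
    rw [pNorm_smul hp (hqY y).le]
  set ρ : ℝ := 1 - ε / N with hρ
  have hεN : ε / N ≤ 1 := (div_le_one hN0).2 (hε1.trans hN1)
  have hρ0 : 0 ≤ ρ := by linarith
  have hρ1 : ρ < 1 := by
    have : 0 < ε / N := div_pos hε hN0
    linarith
  set A : ℝ := pNorm p (fun _ => 1 : Fin N → ℝ) with hA
  have iter : ∀ k : ℕ, ∃ w : Fin N → ℝ, (∀ s, 0 ≤ w s) ∧
      (∀ f : (Fin N → Bool) → ℝ,
        |∑ x, qX x * f x - ∑ y, qY y * f y| ≤ ∑ s, maxDelta f s * w s) ∧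
      pNorm p w ≤ ε⁻¹ * V + ρ ^ k * A := by
    intro k
    induction k with
    | zero =>
      refine ⟨fun _ => 1, fun _ => zero_le_one, fun f => ?_, ?_⟩
      · simpa using abs_sum_sub_sum_le_sum_maxDelta hqX hqXsum hqY hqYsum f
      · have := mul_nonneg (inv_nonneg.2 hε.le) ((pNorm_nonneg hp v).trans hvV)
        rw [pow_zero, one_mul]
        exact le_add_of_nonneg_left this
    | succ k ih =>
      obtain ⟨w, hw, hbound, hnorm⟩ := ih
      refine ⟨(N : ℝ)⁻¹ • (((N : ℝ) - 1) • w + R.mulVec w + v), fun s => ?_, fun f => ?_, ?_⟩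
      · have h1 : 0 ≤ ∑ r, R s r * w r := Finset.sum_nonneg fun r _ =>
          mul_nonneg ((influence_nonneg qX s r).trans (hR s r)) (hw r)
        have h2 := mul_nonneg (sub_nonneg.2 hN1) (hw s)
        exact mul_nonneg (inv_nonneg.2 hN0.le) (add_nonneg (add_nonneg h2 h1) (hv0 s))
      · have key := abs_sum_sub_sum_le_of_resample hqX hqY hR hw hbound f
        rw [mul_comm, ← le_div_iff₀ hN0] at key
        refine key.trans_eq ?_
        rw [div_eq_inv_mul, Finset.mul_sum]
        refine Finset.sum_congr rfl fun s _ => ?_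
        simp only [Pi.smul_apply, Pi.add_apply, smul_eq_mul, hv]
        ring
      · rw [pNorm_smul hp (inv_nonneg.2 hN0.le)]
        have h1 : pNorm p (((N : ℝ) - 1) • w + R.mulVec w + v) ≤
            ((N : ℝ) - 1) * pNorm p w + (1 - ε) * pNorm p w + V := by
          refine (pNorm_add_le hp _ _).trans (add_le_add ((pNorm_add_le hp _ _).trans
            (add_le_add ?_ (hRnorm w))) hvV)
          rw [pNorm_smul hp (sub_nonneg.2 hN1)]
        calc _ ≤ (N : ℝ)⁻¹ * (((N : ℝ) - 1) * pNorm p w + (1 - ε) * pNorm p w + V) :=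
              mul_le_mul_of_nonneg_left h1 (inv_nonneg.2 hN0.le)
          _ = ρ * pNorm p w + (N : ℝ)⁻¹ * V := by
              rw [hρ]; field_simp; ring
          _ ≤ ρ * (ε⁻¹ * V + ρ ^ k * A) + (N : ℝ)⁻¹ * V :=
              add_le_add_left (mul_le_mul_of_nonneg_left hnorm hρ0) _
          _ = _ := by
              have : ρ * (ε⁻¹ * V) + (N : ℝ)⁻¹ * V = ε⁻¹ * V := by
                rw [hρ]; field_simp; ring
              rw [pow_succ]
              linear_combination this
  have hlim : Filter.Tendsto (fun k : ℕ => pNorm q (maxDelta h) * (ε⁻¹ * V + ρ ^ k * A))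
      Filter.atTop (nhds (pNorm q (maxDelta h) * (ε⁻¹ * V + 0 * A))) :=
    (((tendsto_pow_atTop_nhds_zero_of_lt_one hρ0 hρ1).mul_const A).const_add _).const_mul _
  have hfin := ge_of_tendsto' hlim fun k => by
    obtain ⟨w, -, hbound, hnorm⟩ := iter k
    exact (hbound h).trans ((sum_mul_le_pNorm_mul_pNorm hq _ _).trans
      (mul_le_mul_of_nonneg_left hnorm (pNorm_nonneg hq1 _)))
  refine hfin.trans_eq ?_
  change pNorm q (maxDelta h) * _ = ε⁻¹ * pNorm q (maxDelta h) * V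
  ring
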